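/- With the q-quadratic lattice and the operators D_x, S_x as in the context, for every integer n ≥ 3 there exist polynomials r and ρ with deg r ≤ n−4 and deg ρ ≤ n−3 such that D_x(X^n) = γ_n X^{n-1} + u_n X^{n-2} + v_n X^{n-3} + r and S_x(X^n) = α_n X^n + û_n X^{n-1} + v̂_n X^{n-2} + ρ, where u_n = (nγ_{n−1} − (n−1)γ_n)𝔠₃, v_n = (nγ_{n−2} − (n−2)γ_n)𝔠₁𝔠₂ + (1/2)(n(n−1)γ_{n−2} − 2n(n−2)γ_{n−1} + (n−1)(n−2)γ_n)𝔠₃², û_n = n(α_{n−1} − α_n)𝔠₃, and v̂_n = n(α_{n−2} − α_n)𝔠₁𝔠₂ + n(n−1)(α−1)α_{n−1}𝔠₃². -/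

import Mathlib

open Polynomial

noncomputable def qp (q : ℝ) (t : ℂ) : ℂ := Complex.exp (t * (Real.log q : ℂ))

noncomputable def alphaL (q : ℝ) : ℂ := (qp q (1/2) + qp q (-(1/2))) / 2

noncomputable def alphaN (q : ℝ) (n : ℕ) : ℂ :=
  (qp q ((n : ℂ) / 2) + qp q (-((n : ℂ) / 2))) / 2

noncomputable def gammaN (q : ℝ) (n : ℕ) : ℂ :=
  (qp q ((n : ℂ) / 2) - qp q (-((n : ℂ) / 2))) / (qp q (1/2) - qp q (-(1/2)))

noncomputable def latX (q : ℝ) (c1 c2 c3 s : ℂ) : ℂ := c1 * qp q (-s) + c2 * qp q s + c3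

/-- A polynomial sequence satisfying a three-term recurrence with coefficients of degree one and two
has its three leading coefficients governed by the induced scalar recurrences. The factor `X ^ k`
lets the initial terms be written without negative exponents. -/
lemma exists_expansion_of_recurrence {R : Type*} [CommRing R] (P : ℕ → R[X]) (a b c : ℕ → R)
    (α β b₁ b₀ : R) (k : ℕ)
    (hP : ∀ n, P (n + 2) = (C (2 * α) * X + C (2 * β)) * P (n + 1) -
      (X ^ 2 + C b₁ * X + C b₀) * P n)
    (ha : ∀ n, a (n + 2) = 2 * α * a (n + 1) - a n)
    (hb : ∀ n, b (n + 2) = 2 * α * b (n + 1) + 2 * β * a (n + 1) - b n - b₁ * a n)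
    (hc : ∀ n, c (n + 2) =
      2 * α * c (n + 1) + 2 * β * b (n + 1) - c n - b₁ * b n - b₀ * a n)
    (h0 : X ^ k * P 0 = C (a 0) * X ^ 2 + C (b 0) * X + C (c 0))
    (h1 : X ^ k * P 1 = C (a 1) * X ^ 3 + C (b 1) * X ^ 2 + C (c 1) * X) (n : ℕ) :
    ∃ r : R[X], r.degree < (n : WithBot ℕ) ∧
      P (n + k) = C (a (n + k)) * X ^ (n + 2) + C (b (n + k)) * X ^ (n + 1) +
        C (c (n + k)) * X ^ n + r := by
  have key : ∀ n : ℕ, ∃ r : R[X], (∀ m, n ≤ m → r.coeff m = 0) ∧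
      X ^ k * P n = C (a n) * X ^ (n + 2) + C (b n) * X ^ (n + 1) + C (c n) * X ^ n + r := by
    intro n
    induction n using Nat.twoStepInduction with
    | zero => exact ⟨0, by simp, by simp [h0]⟩
    | one => exact ⟨0, by simp, by simp [h1]⟩
    | more n ih0 ih1 =>
      obtain ⟨r, hr, e0⟩ := ih0
      obtain ⟨t, ht, e1⟩ := ih1
      refine ⟨C (2 * α) * (t * X) + C (2 * β) * t - r * X ^ 2 - C b₁ * (r * X) - C b₀ * r +
        C (2 * β * c (n + 1) - b₁ * c n - b₀ * b n) * X ^ (n + 1) - C (b₀ * c n) * X ^ n, ?_, ?_⟩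
      · intro m hm
        obtain ⟨j, rfl⟩ : ∃ j, m = j + 2 := ⟨m - 2, by omega⟩
        have hX : (t * X).coeff (j + 2) = 0 := by
          rw [show j + 2 = (j + 1) + 1 from rfl, coeff_mul_X]; exact ht _ (by omega)
        have hX' : (r * X).coeff (j + 2) = 0 := by
          rw [show j + 2 = (j + 1) + 1 from rfl, coeff_mul_X]; exact hr _ (by omega)
        have hX2 : (r * X ^ 2).coeff (j + 2) = 0 := by
          rw [coeff_mul_X_pow]; exact hr _ (by omega)
        simp only [coeff_add, coeff_sub, coeff_C_mul, hX, hX', hX2, ht (j + 2) (by omega),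
          hr (j + 2) (by omega), coeff_X_pow, if_neg (show j + 2 ≠ n + 1 by omega),
          if_neg (show j + 2 ≠ n by omega)]
        ring
      · have : X ^ k * P (n + 2) = (C (2 * α) * X + C (2 * β)) * (X ^ k * P (n + 1)) -
            (X ^ 2 + C b₁ * X + C b₀) * (X ^ k * P n) := by rw [hP]; ring
        rw [this, e0, e1, ha, hb, hc]
        simp only [C_add, C_sub, C_mul]
        ring
  obtain ⟨r, hr, e⟩ := key (n + k)
  refine ⟨P (n + k) - (C (a (n + k)) * X ^ (n + 2) + C (b (n + k)) * X ^ (n + 1) +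
    C (c (n + k)) * X ^ n), ?_, by ring⟩
  rw [degree_lt_iff_coeff_zero]
  intro m hm
  rw [← coeff_X_pow_mul _ k m, show X ^ k * (P (n + k) - (C (a (n + k)) * X ^ (n + 2) +
    C (b (n + k)) * X ^ (n + 1) + C (c (n + k)) * X ^ n)) = r by rw [mul_sub, e]; ring]
  exact hr _ (by omega)

lemma qp_ne_zero (q : ℝ) (t : ℂ) : qp q t ≠ 0 := Complex.exp_ne_zero _

lemma qp_add (q : ℝ) (s t : ℂ) : qp q (s + t) = qp q s * qp q t := by
  simp only [qp, add_mul, Complex.exp_add]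

lemma qp_neg (q : ℝ) (t : ℂ) : qp q (-t) = (qp q t)⁻¹ := by
  simp only [qp, neg_mul, Complex.exp_neg]

lemma qp_sub (q : ℝ) (s t : ℂ) : qp q (s - t) = qp q s * (qp q t)⁻¹ := by
  rw [sub_eq_add_neg, qp_add, qp_neg]

lemma qp_zero (q : ℝ) : qp q 0 = 1 := by simp [qp]

lemma qp_half_sq {q : ℝ} (hq : 0 < q) : qp q (1 / 2) ^ 2 = q := by
  rw [sq, ← qp_add, qp, add_halves, one_mul, ← Complex.ofReal_exp, Real.exp_log hq]

lemma qp_half_sub_ne_zero {q : ℝ} (hq : 0 < q) (hq1 : q ≠ 1) :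
    qp q (1 / 2) - qp q (-(1 / 2)) ≠ 0 := by
  intro h
  have hp := qp_ne_zero q (1 / 2)
  rw [qp_neg, sub_eq_zero] at h
  have h1 : qp q (1 / 2) ^ 2 = 1 := by
    rw [sq]; nth_rewrite 2 [h]; exact mul_inv_cancel₀ hp
  rw [qp_half_sq hq] at h1
  exact hq1 (by exact_mod_cast h1)

lemma qp_surjective {q : ℝ} (hq : 0 < q) (hq1 : q ≠ 1) {w : ℂ} (hw : w ≠ 0) :
    ∃ s, qp q s = w := by
  have hl : (Real.log q : ℂ) ≠ 0 := by
    exact_mod_cast Real.log_ne_zero_of_pos_of_ne_one hq hq1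
  exact ⟨Complex.log w / Real.log q, by rw [qp, div_mul_cancel₀ _ hl, Complex.exp_log hw]⟩

lemma latX_surjective {q : ℝ} (hq : 0 < q) (hq1 : q ≠ 1) {c1 c2 : ℂ} (hc : c1 * c2 ≠ 0)
    (c3 : ℂ) : Function.Surjective (latX q c1 c2 c3) := by
  intro x
  obtain ⟨h1, h2⟩ := mul_ne_zero_iff.mp hc
  obtain ⟨d, hd⟩ := IsAlgClosed.exists_pow_nat_eq ((x - c3) ^ 2 - 4 * (c1 * c2)) two_pos
  have hroot : c2 * (((x - c3) + d) / (2 * c2)) ^ 2 -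
      (x - c3) * (((x - c3) + d) / (2 * c2)) + c1 = 0 := by
    field_simp
    linear_combination hd
  set w := ((x - c3) + d) / (2 * c2)
  have hw : w ≠ 0 := by
    intro h
    rw [h] at hroot
    exact h1 (by simpa using hroot)
  obtain ⟨s, hs⟩ := qp_surjective hq hq1 hw
  refine ⟨s, ?_⟩
  rw [latX, qp_neg, hs]
  field_simp
  linear_combination hroot

lemma latX_add_half_add_sub_half (q : ℝ) (c1 c2 c3 s : ℂ) :
    latX q c1 c2 c3 (s + 1 / 2) + latX q c1 c2 c3 (s - 1 / 2) =
      2 * alphaL q * latX q c1 c2 c3 s + 2 * ((1 - alphaL q) * c3) := by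
  have hp := qp_ne_zero q (1 / 2)
  have hw := qp_ne_zero q s
  simp only [latX, alphaL, qp_neg, qp_add, qp_sub]
  field_simp
  ring

lemma latX_add_half_mul_sub_half (q : ℝ) (c1 c2 c3 s : ℂ) :
    latX q c1 c2 c3 (s + 1 / 2) * latX q c1 c2 c3 (s - 1 / 2) =
      latX q c1 c2 c3 s ^ 2 + (2 * alphaL q - 2) * c3 * latX q c1 c2 c3 s +
        ((2 - 2 * alphaL q) * c3 ^ 2 + 4 * (alphaL q ^ 2 - 1) * (c1 * c2)) := by
  have hp := qp_ne_zero q (1 / 2)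
  have hw := qp_ne_zero q s
  simp only [latX, alphaL, qp_neg, qp_add, qp_sub]
  field_simp
  ring

lemma latX_add_half_sub_sub_half_sq (q : ℝ) (c1 c2 c3 s : ℂ) :
    (latX q c1 c2 c3 (s + 1 / 2) - latX q c1 c2 c3 (s - 1 / 2)) ^ 2 =
      (qp q (1 / 2) - qp q (-(1 / 2))) ^ 2 *
        ((latX q c1 c2 c3 s - c3) ^ 2 - 4 * (c1 * c2)) := by
  have hp := qp_ne_zero q (1 / 2)
  have hw := qp_ne_zero q s
  simp only [latX, qp_neg, qp_add, qp_sub]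
  field_simp
  ring

/-- Polynomials agreeing on the nondegenerate points of the lattice are equal. -/
lemma eq_of_eval_latX {q : ℝ} (hq : 0 < q) (hq1 : q ≠ 1) {c1 c2 : ℂ} (hc : c1 * c2 ≠ 0)
    {c3 : ℂ} {P Q : ℂ[X]}
    (h : ∀ s, latX q c1 c2 c3 (s + 1 / 2) ≠ latX q c1 c2 c3 (s - 1 / 2) →
      P.eval (latX q c1 c2 c3 s) = Q.eval (latX q c1 c2 c3 s)) : P = Q := by
  have hne : ((X - C c3) ^ 2 - C (4 * (c1 * c2)) : ℂ[X]) ≠ 0 := by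
    intro h0
    have := congrArg (eval c3) h0
    simp at this
    exact hc (by simpa using this)
  apply mul_left_cancel₀ hne
  refine funext fun x => ?_
  obtain ⟨s, rfl⟩ := latX_surjective hq hq1 hc c3 x
  by_cases hs : latX q c1 c2 c3 (s + 1 / 2) = latX q c1 c2 c3 (s - 1 / 2)
  · have h2 := latX_add_half_sub_sub_half_sq q c1 c2 c3 s
    rw [hs, sub_self, zero_pow two_ne_zero, eq_comm, mul_eq_zero] at h2
    have h3 := h2.resolve_left (pow_ne_zero 2 (qp_half_sub_ne_zero hq hq1))
    simp [h3]
  · rw [eval_mul, eval_mul, h s hs]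

/-- `alphaN` shifted by two, extended to the indices `-2` and `-1`. -/
noncomputable def alphaShift (q : ℝ) (n : ℕ) : ℂ :=
  (qp q (((n : ℂ) - 2) / 2) + qp q (-(((n : ℂ) - 2) / 2))) / 2

/-- `gammaN` shifted by two, extended to the indices `-2` and `-1`. -/
noncomputable def gammaShift (q : ℝ) (n : ℕ) : ℂ :=
  (qp q (((n : ℂ) - 2) / 2) - qp q (-(((n : ℂ) - 2) / 2))) / (qp q (1 / 2) - qp q (-(1 / 2)))

lemma alphaShift_add_two (q : ℝ) (n : ℕ) : alphaShift q (n + 2) = alphaN q n := by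
  simp [alphaShift, alphaN]

lemma gammaShift_add_two (q : ℝ) (n : ℕ) : gammaShift q (n + 2) = gammaN q n := by
  simp [gammaShift, gammaN]

lemma alphaShift_recurrence (q : ℝ) (n : ℕ) :
    alphaShift q (n + 2) = 2 * alphaL q * alphaShift q (n + 1) - alphaShift q n := by
  have hp := qp_ne_zero q (1 / 2)
  have hw := qp_ne_zero q (((n : ℂ) - 2) / 2)
  simp only [alphaShift, alphaL]
  rw [show (((n + 2 : ℕ) : ℂ) - 2) / 2 = ((n : ℂ) - 2) / 2 + 1 / 2 + 1 / 2 by push_cast; ring,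
    show (((n + 1 : ℕ) : ℂ) - 2) / 2 = ((n : ℂ) - 2) / 2 + 1 / 2 by push_cast; ring]
  simp only [qp_neg, qp_add]
  field_simp
  ring

lemma gammaShift_recurrence (q : ℝ) (n : ℕ) :
    gammaShift q (n + 2) = 2 * alphaL q * gammaShift q (n + 1) - gammaShift q n := by
  have hp := qp_ne_zero q (1 / 2)
  have hw := qp_ne_zero q (((n : ℂ) - 2) / 2)
  simp only [gammaShift, alphaL]
  rw [show (((n + 2 : ℕ) : ℂ) - 2) / 2 = ((n : ℂ) - 2) / 2 + 1 / 2 + 1 / 2 by push_cast; ring,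
    show (((n + 1 : ℕ) : ℂ) - 2) / 2 = ((n : ℂ) - 2) / 2 + 1 / 2 by push_cast; ring,
    mul_div_assoc', ← sub_div]
  congr 1
  simp only [qp_neg, qp_add]
  field_simp
  ring

lemma alphaShift_one (q : ℝ) : alphaShift q 1 = alphaL q := by
  rw [alphaShift, alphaL, show (((1 : ℕ) : ℂ) - 2) / 2 = -(1 / 2) by norm_num, neg_neg, add_comm]

lemma alphaShift_two (q : ℝ) : alphaShift q 2 = 1 := by
  simp [alphaShift, qp_zero]

lemma alphaShift_three (q : ℝ) : alphaShift q 3 = alphaL q := by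
  rw [alphaShift_recurrence q 1, alphaShift_two, alphaShift_one]; ring

lemma gammaShift_two (q : ℝ) : gammaShift q 2 = 0 := by
  simp [gammaShift]

lemma gammaShift_three {q : ℝ} (hq : 0 < q) (hq1 : q ≠ 1) : gammaShift q 3 = 1 := by
  rw [gammaShift, show (((3 : ℕ) : ℂ) - 2) / 2 = 1 / 2 by norm_num]
  exact div_self (qp_half_sub_ne_zero hq hq1)

lemma gammaShift_one {q : ℝ} (hq : 0 < q) (hq1 : q ≠ 1) : gammaShift q 1 = -1 := by
  have h := gammaShift_recurrence q 1
  rw [gammaShift_three hq hq1, gammaShift_two] at h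
  linear_combination h

/-- The recurrence in `n` shared by all divided differences and means of `X ^ n`. -/
lemma pow_recurrence (q : ℝ) (c1 c2 c3 s : ℂ) (n : ℕ) (y : ℂ)
    (hy : y = latX q c1 c2 c3 (s + 1 / 2) ∨ y = latX q c1 c2 c3 (s - 1 / 2)) :
    y ^ (n + 2) = (2 * alphaL q * latX q c1 c2 c3 s + 2 * ((1 - alphaL q) * c3)) * y ^ (n + 1) -
      (latX q c1 c2 c3 s ^ 2 + (2 * alphaL q - 2) * c3 * latX q c1 c2 c3 s +
        ((2 - 2 * alphaL q) * c3 ^ 2 + 4 * (alphaL q ^ 2 - 1) * (c1 * c2))) * y ^ n := by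
  rw [← latX_add_half_add_sub_half, ← latX_add_half_mul_sub_half]
  rcases hy with rfl | rfl <;> ring

theorem stmt_6 (q : ℝ) (hq : 0 < q) (hq1 : q ≠ 1) (c1 c2 c3 : ℂ) (hc : c1 * c2 ≠ 0)
    (Dx Sx : Polynomial ℂ → Polynomial ℂ)
    (hDx : ∀ (f : Polynomial ℂ) (s : ℂ),
      latX q c1 c2 c3 (s + 1/2) ≠ latX q c1 c2 c3 (s - 1/2) →
      (Dx f).eval (latX q c1 c2 c3 s) =
        (f.eval (latX q c1 c2 c3 (s + 1/2)) - f.eval (latX q c1 c2 c3 (s - 1/2))) /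
          (latX q c1 c2 c3 (s + 1/2) - latX q c1 c2 c3 (s - 1/2)))
    (hSx : ∀ (f : Polynomial ℂ) (s : ℂ),
      (Sx f).eval (latX q c1 c2 c3 s) =
        (f.eval (latX q c1 c2 c3 (s + 1/2)) + f.eval (latX q c1 c2 c3 (s - 1/2))) / 2)
    :
    ∀ n : ℕ, 3 ≤ n →
      ∃ r ρ : Polynomial ℂ,
        r.degree < ((n - 3 : ℕ) : WithBot ℕ) ∧ ρ.degree < ((n - 2 : ℕ) : WithBot ℕ) ∧
        Dx (X ^ n) =
          C (gammaN q n) * X ^ (n - 1) +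
          C (((n : ℂ) * gammaN q (n - 1) - ((n : ℂ) - 1) * gammaN q n) * c3) * X ^ (n - 2) +
          C (((n : ℂ) * gammaN q (n - 2) - ((n : ℂ) - 2) * gammaN q n) * (c1 * c2) +
            (1/2) * ((n : ℂ) * ((n : ℂ) - 1) * gammaN q (n - 2) -
              2 * (n : ℂ) * ((n : ℂ) - 2) * gammaN q (n - 1) +
              ((n : ℂ) - 1) * ((n : ℂ) - 2) * gammaN q n) * c3 ^ 2) * X ^ (n - 3) + r ∧
        Sx (X ^ n) =
          C (alphaN q n) * X ^ n +
          C ((n : ℂ) * (alphaN q (n - 1) - alphaN q n) * c3) * X ^ (n - 1) +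
          C ((n : ℂ) * (alphaN q (n - 2) - alphaN q n) * (c1 * c2) +
            (n : ℂ) * ((n : ℂ) - 1) * (alphaL q - 1) * alphaN q (n - 1) * c3 ^ 2) * X ^ (n - 2) +
          ρ := by
  intro n hn
  obtain ⟨m, rfl⟩ : ∃ m, n = m + 3 := ⟨n - 3, by omega⟩
  have hD := exists_expansion_of_recurrence (fun n => Dx (X ^ n))
    (fun n => gammaShift q (n + 2))
    (fun n => ((n : ℂ) * gammaShift q (n + 1) - ((n : ℂ) - 1) * gammaShift q (n + 2)) * c3)
    (fun n => ((n : ℂ) * gammaShift q n - ((n : ℂ) - 2) * gammaShift q (n + 2)) * (c1 * c2) +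
            (1/2) * ((n : ℂ) * ((n : ℂ) - 1) * gammaShift q n -
              2 * (n : ℂ) * ((n : ℂ) - 2) * gammaShift q (n + 1) +
              ((n : ℂ) - 1) * ((n : ℂ) - 2) * gammaShift q (n + 2)) * c3 ^ 2)
    (alphaL q) ((1 - alphaL q) * c3) ((2 * alphaL q - 2) * c3)
    ((2 - 2 * alphaL q) * c3 ^ 2 + 4 * (alphaL q ^ 2 - 1) * (c1 * c2)) 3
    (by
      intro n
      refine eq_of_eval_latX hq hq1 hc (c3 := c3) fun s hs => ?_
      simp only [eval_sub, eval_mul, eval_add, eval_C, eval_X, eval_pow, hDx _ s hs]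
      rw [pow_recurrence q c1 c2 c3 s n _ (Or.inl rfl),
        pow_recurrence q c1 c2 c3 s n _ (Or.inr rfl)]
      ring)
    (fun n => gammaShift_recurrence q (n + 2))
    (by
      intro n
      simp only [gammaShift_recurrence]
      push_cast
      ring)
    (by
      intro n
      simp only [gammaShift_recurrence]
      push_cast
      ring)
    (by
      have h : Dx 1 = 0 := by
        refine eq_of_eval_latX hq hq1 hc (c3 := c3) fun s hs => ?_
        simp [hDx _ s hs]
      simp [h, gammaShift_two])
    (by
      have h : Dx X = 1 := by
        refine eq_of_eval_latX hq hq1 hc (c3 := c3) fun s hs => ?_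
        simp only [hDx _ s hs, eval_X, eval_one]
        exact div_self (sub_ne_zero.mpr hs)
      norm_num [h, gammaShift_two, gammaShift_three hq hq1, gammaShift_one hq hq1])
    m
  have hS := exists_expansion_of_recurrence (fun n => Sx (X ^ n))
    (fun n => alphaShift q (n + 2))
    (fun n => (n : ℂ) * (alphaShift q (n + 1) - alphaShift q (n + 2)) * c3)
    (fun n => (n : ℂ) * (alphaShift q n - alphaShift q (n + 2)) * (c1 * c2) +
            (n : ℂ) * ((n : ℂ) - 1) * (alphaL q - 1) * alphaShift q (n + 1) * c3 ^ 2)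
    (alphaL q) ((1 - alphaL q) * c3) ((2 * alphaL q - 2) * c3)
    ((2 - 2 * alphaL q) * c3 ^ 2 + 4 * (alphaL q ^ 2 - 1) * (c1 * c2)) 2
    (by
      intro n
      refine eq_of_eval_latX hq hq1 hc (c3 := c3) fun s _ => ?_
      simp only [eval_sub, eval_mul, eval_add, eval_C, eval_X, eval_pow, hSx _ s]
      rw [pow_recurrence q c1 c2 c3 s n _ (Or.inl rfl),
        pow_recurrence q c1 c2 c3 s n _ (Or.inr rfl)]
      ring)
    (fun n => alphaShift_recurrence q (n + 2))
    (by
      intro n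
      simp only [alphaShift_recurrence]
      push_cast
      ring)
    (by
      intro n
      simp only [alphaShift_recurrence]
      push_cast
      ring)
    (by
      have h : Sx 1 = 1 := by
        refine eq_of_eval_latX hq hq1 hc (c3 := c3) fun s _ => ?_
        simp [hSx _ s]
      simp [h, alphaShift_two])
    (by
      have h : Sx X = C (alphaL q) * X + C ((1 - alphaL q) * c3) := by
        refine eq_of_eval_latX hq hq1 hc (c3 := c3) fun s _ => ?_
        simp only [hSx _ s, eval_X, eval_add, eval_mul, eval_C,
          latX_add_half_add_sub_half]
        ring
      simp only [pow_one, h, alphaShift_one, alphaShift_two, alphaShift_three, Nat.cast_one, Nat.reduceAdd]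
      simp
      ring)
    (m + 1)
  obtain ⟨r, hr, hr'⟩ := hD
  obtain ⟨ρ, hρ, hρ'⟩ := hS
  refine ⟨r, ρ, by simpa using hr, by simpa using hρ, ?_, ?_⟩
  · simp only [← gammaShift_add_two]
    exact hr'
  · simp only [← alphaShift_add_two]
    exact hρ'
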